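/- arXiv:2307.11372 — 3 statements merged into one kernel-verified Lean document; each statement's English description precedes it below -/
import Mathlib

section
/- Let Φ : 𝒫 → 𝒫 be a support-preserving multiplicative map. Then there exists a real constant γ > 0 such that for every real a > 0, Φ[(X+a)/(1+a)] = (X+γa)/(1+γa). -/
open Polynomial

/-- `Pset` is the set of real polynomials with nonnegative coefficients summing to 1. -/
def Pset : Set (Polynomial ℝ) := {p | (∀ k, 0 ≤ p.coeff k) ∧ p.eval 1 = 1}

/-- The normalized linear polynomial `(X + a)/(1 + a)`. -/
noncomputable def lin (a : ℝ) : Polynomial ℝ := C (1 + a)⁻¹ * (X + C a)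

/-- The rescaling of `p` whose coefficients sum to `1` (when `p.eval 1 ≠ 0`). -/
noncomputable def normalize1 (p : ℝ[X]) : ℝ[X] := C (p.eval 1)⁻¹ * p

theorem normalize1_mem {p : ℝ[X]} (hp : ∀ k, 0 ≤ p.coeff k) (h1 : 0 < p.eval 1) :
    normalize1 p ∈ Pset := by
  refine ⟨fun k => ?_, ?_⟩
  · rw [normalize1, coeff_C_mul]
    exact mul_nonneg (inv_nonneg.2 h1.le) (hp k)
  · simp [normalize1, h1.ne']

theorem normalize1_mul (p q : ℝ[X]) : normalize1 (p * q) = normalize1 p * normalize1 q := by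
  simp only [normalize1, eval_mul, mul_inv, C_mul]
  ring

theorem normalize1_coeff_pos {p : ℝ[X]} (h1 : 0 < p.eval 1) (k : ℕ) :
    0 < (normalize1 p).coeff k ↔ 0 < p.coeff k := by
  rw [normalize1, coeff_C_mul, mul_pos_iff_of_pos_left (inv_pos.2 h1)]

theorem normalize1_X_add_C (a : ℝ) : normalize1 (X + C a) = lin a := by
  simp [normalize1, lin]

theorem lin_mem {a : ℝ} (ha : 0 < a) : lin a ∈ Pset := by
  rw [← normalize1_X_add_C]
  refine normalize1_mem (fun k => ?_) (by simp; positivity)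
  rw [coeff_add, coeff_X, coeff_C]
  split_ifs <;> linarith

theorem coeff_map_eq_zero {Φ : ℝ[X] → ℝ[X]}
    (hmap : ∀ p ∈ Pset, Φ p ∈ Pset)
    (hsupp : ∀ p ∈ Pset, ∀ k : ℕ, 0 < (Φ p).coeff k ↔ 0 < p.coeff k)
    {p : ℝ[X]} (hp : p ∈ Pset) {k : ℕ} (hk : p.coeff k = 0) : (Φ p).coeff k = 0 := by
  refine le_antisymm (not_lt.1 fun h => ?_) ((hmap p hp).1 k)
  exact ((hsupp p hp k).1 h).ne' hk

theorem exists_map_lin {Φ : ℝ[X] → ℝ[X]}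
    (hmap : ∀ p ∈ Pset, Φ p ∈ Pset)
    (hsupp : ∀ p ∈ Pset, ∀ k : ℕ, 0 < (Φ p).coeff k ↔ 0 < p.coeff k)
    (a : ℝ) (ha : 0 < a) : ∃ b, 0 < b ∧ Φ (lin a) = lin b := by
  have hm := lin_mem ha
  have h0 : 0 < (Φ (lin a)).coeff 0 := (hsupp _ hm 0).2 (by
    simp [lin]; positivity)
  have h1 : 0 < (Φ (lin a)).coeff 1 := (hsupp _ hm 1).2 (by
    simp [lin]; positivity)
  have hform : Φ (lin a) = C ((Φ (lin a)).coeff 1) * X + C ((Φ (lin a)).coeff 0) := by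
    ext k
    match k with
    | 0 => simp
    | 1 => simp [coeff_C]
    | k + 2 =>
      rw [coeff_map_eq_zero hmap hsupp hm (by simp [lin, coeff_X])]
      simp
  have hs := (hmap _ hm).2
  generalize (Φ (lin a)).coeff 0 = u at *
  generalize (Φ (lin a)).coeff 1 = v at *
  rw [hform] at hs ⊢
  simp at hs
  refine ⟨u / v, by positivity, ?_⟩
  have hv : (1 + u / v)⁻¹ = v := by
    field_simp
    linarith
  rw [lin, hv, mul_add, ← C_mul, mul_div_cancel₀ _ h1.ne']

theorem exists_map_cubic {Φ : ℝ[X] → ℝ[X]}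
    (hmap : ∀ p ∈ Pset, Φ p ∈ Pset)
    (hsupp : ∀ p ∈ Pset, ∀ k : ℕ, 0 < (Φ p).coeff k ↔ 0 < p.coeff k)
    {t : ℝ} (ht : 0 < t) :
    ∃ u v, 0 < u ∧ Φ (normalize1 (X ^ 3 + C t)) = C u * X ^ 3 + C v := by
  have hev : 0 < (X ^ 3 + C t : ℝ[X]).eval 1 := by simp; positivity
  have hm : normalize1 (X ^ 3 + C t) ∈ Pset := by
    refine normalize1_mem (fun k => ?_) hev
    rw [coeff_add, coeff_X_pow, coeff_C]
    split_ifs <;> linarith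
  refine ⟨_, (Φ (normalize1 (X ^ 3 + C t))).coeff 0, (hsupp _ hm 3).2 ?_, ?_⟩
  · rw [normalize1_coeff_pos hev]
    simp
  ext k
  match k with
  | 0 => simp
  | 1 | 2 | k + 4 =>
    rw [coeff_map_eq_zero hmap hsupp hm (by simp [normalize1, coeff_X_pow])]
    simp [coeff_X_pow]
  | 3 => simp

theorem lin_ne_zero {a : ℝ} (ha : 0 < a) : lin a ≠ 0 := by
  intro h
  have := (lin_mem ha).2
  simp [h] at this

theorem map_lin_ne {Φ : ℝ[X] → ℝ[X]}
    (hmap : ∀ p ∈ Pset, Φ p ∈ Pset)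
    (hsupp : ∀ p ∈ Pset, ∀ k : ℕ, 0 < (Φ p).coeff k ↔ 0 < p.coeff k)
    (hmul : ∀ p ∈ Pset, ∀ q ∈ Pset, Φ (p * q) = Φ p * Φ q)
    {c e : ℝ} (hc : 0 < c) (he : c < e) : Φ (lin c) ≠ Φ (lin e) := by
  intro heq
  have he0 : 0 < e := hc.trans he
  set S : ℝ[X] := X ^ 3 + C (c * (e - c)) * X + C (c ^ 2 * e) with hS
  set T : ℝ[X] := X ^ 3 + C (e - c) * X ^ 2 + C (c * e ^ 2) with hT
  have hd : 0 < e - c := sub_pos.2 he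
  have hSev : 0 < S.eval 1 := by
    simp only [hS, eval_add, eval_mul, eval_pow, eval_X, eval_C]; positivity
  have hTev : 0 < T.eval 1 := by
    simp only [hT, eval_add, eval_mul, eval_pow, eval_X, eval_C]; positivity
  have hSm : normalize1 S ∈ Pset := by
    refine normalize1_mem (fun k => ?_) hSev
    simp only [hS, coeff_add, coeff_C_mul, coeff_X_pow, coeff_X, coeff_C]
    split_ifs <;> positivity
  have hTm : normalize1 T ∈ Pset := by
    refine normalize1_mem (fun k => ?_) hTev
    simp only [hT, coeff_add, coeff_C_mul, coeff_X_pow, coeff_C]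
    split_ifs <;> positivity
  have hST : normalize1 S * lin e = normalize1 T * lin c := by
    rw [← normalize1_X_add_C, ← normalize1_X_add_C, ← normalize1_mul, ← normalize1_mul]
    congr 1
    simp only [hS, hT, C_mul, C_sub, C_pow]
    ring
  have h := congrArg Φ hST
  rw [hmul _ hSm _ (lin_mem he0), hmul _ hTm _ (lin_mem hc), heq] at h
  have hne : Φ (lin e) ≠ 0 := by
    intro h0
    have := (hmap _ (lin_mem he0)).2
    simp [h0] at this
  have hΦ := mul_right_cancel₀ hne h
  have h1 : 0 < (Φ (normalize1 S)).coeff 1 := by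
    rw [hsupp _ hSm, normalize1_coeff_pos hSev]
    simp only [hS, coeff_add, coeff_C_mul, coeff_X_pow, coeff_X, coeff_C]
    norm_num
    exact mul_pos hc hd
  have h2 : (normalize1 T).coeff 1 = 0 := by
    simp only [normalize1, hT, coeff_add, coeff_C_mul, coeff_X_pow, coeff_C]
    norm_num
  rw [hΦ, coeff_map_eq_zero hmap hsupp hTm h2] at h1
  exact h1.false

theorem map_lin_add {Φ : ℝ[X] → ℝ[X]}
    (hmap : ∀ p ∈ Pset, Φ p ∈ Pset)
    (hsupp : ∀ p ∈ Pset, ∀ k : ℕ, 0 < (Φ p).coeff k ↔ 0 < p.coeff k)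
    (hmul : ∀ p ∈ Pset, ∀ q ∈ Pset, Φ (p * q) = Φ p * Φ q)
    {f : ℝ → ℝ} (hf0 : ∀ a, 0 < a → 0 < f a) (hf : ∀ a, 0 < a → Φ (lin a) = lin (f a))
    {b d : ℝ} (hb : 0 < b) (hd : 0 < d) : f (b + d) = f b + f d := by
  have ha : 0 < b + d := add_pos hb hd
  have hba : f b ≠ f (b + d) := fun h =>
    map_lin_ne hmap hsupp hmul hb (lt_add_of_pos_right b hd) (by rw [hf _ hb, hf _ ha, h])
  have hda : f d ≠ f (b + d) := fun h =>
    map_lin_ne hmap hsupp hmul hd (lt_add_of_pos_left d hb) (by rw [hf _ hd, hf _ ha, h])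
  set U : ℝ[X] := X ^ 4 + C (b * d) * X ^ 2 + C ((b + d) * (b ^ 2 + b * d + d ^ 2)) * X
    + C ((b + d) ^ 2 * (b * d)) with hU
  have hUev : 0 < U.eval 1 := by
    simp only [hU, eval_add, eval_mul, eval_pow, eval_X, eval_C]; positivity
  have hUm : normalize1 U ∈ Pset := by
    refine normalize1_mem (fun k => ?_) hUev
    simp only [hU, coeff_add, coeff_C_mul, coeff_X_pow, coeff_X, coeff_C]
    split_ifs <;> positivity
  have hVm : normalize1 (X ^ 3 + C ((b + d) ^ 3)) ∈ Pset := by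
    refine normalize1_mem (fun k => ?_) (by simp; positivity)
    rw [coeff_add, coeff_X_pow, coeff_C]
    split_ifs <;> positivity
  have hbd : lin b * lin d ∈ Pset := by
    rw [← normalize1_X_add_C, ← normalize1_X_add_C, ← normalize1_mul]
    refine normalize1_mem (fun k => ?_) (by simp; positivity)
    have : (X + C b) * (X + C d) = X ^ 2 + C (b + d) * X + C (b * d) := by
      simp only [C_add, C_mul]; ring
    simp only [this, coeff_add, coeff_C_mul, coeff_X_pow, coeff_X, coeff_C]
    split_ifs <;> positivity
  have hrel : normalize1 U * lin (b + d)
      = lin b * lin d * normalize1 (X ^ 3 + C ((b + d) ^ 3)) := by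
    simp only [← normalize1_X_add_C, ← normalize1_mul]
    congr 1
    simp only [hU, C_add, C_mul, C_pow]
    ring
  have h := congrArg Φ hrel
  obtain ⟨u, v, hu, huv⟩ := exists_map_cubic hmap hsupp (pow_pos ha 3)
  rw [hmul _ hUm _ (lin_mem ha), hmul _ hbd _ hVm, hmul _ (lin_mem hb) _ (lin_mem hd),
    hf _ ha, hf _ hb, hf _ hd, huv] at h
  have h3 : (Φ (normalize1 U)).coeff 3 = 0 :=
    coeff_map_eq_zero hmap hsupp hUm (by
      simp only [normalize1, hU, coeff_add, coeff_C_mul, coeff_X_pow, coeff_X, coeff_C]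
      norm_num)
  have hA := hf0 _ ha
  have hB := hf0 _ hb
  have hD := hf0 _ hd
  generalize f (b + d) = A at *
  generalize f b = B at *
  generalize f d = D at *
  have hB1 : (1 + B)⁻¹ ≠ 0 := by positivity
  have hD1 : (1 + D)⁻¹ ≠ 0 := by positivity
  have hv : v = u * A ^ 3 := by
    have he := congrArg (eval (-A)) h
    simp only [lin, eval_mul, eval_add, eval_C, eval_X, eval_pow, neg_add_cancel, mul_zero] at he
    have h1 : -A + B ≠ 0 := fun h => hba (by linarith)
    have h2 : -A + D ≠ 0 := fun h => hda (by linarith)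
    have := (mul_eq_zero.1 he.symm).resolve_left
      (mul_ne_zero (mul_ne_zero hB1 h1) (mul_ne_zero hD1 h2))
    linear_combination this
  set κ : ℝ := (1 + A) * (1 + B)⁻¹ * (1 + D)⁻¹ * u with hκ
  have hκ0 : κ ≠ 0 := by positivity
  have hκu : (1 + A)⁻¹ * κ = (1 + B)⁻¹ * (1 + D)⁻¹ * u := by
    rw [hκ]; field_simp
  have hfac : Φ (normalize1 U) = C κ * (X ^ 4 + C (B + D - A) * X ^ 3
      + C (B * D - (B + D) * A + A ^ 2) * X ^ 2 + C ((B + D) * A ^ 2 - B * D * A) * X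
      + C (B * D * A ^ 2)) := by
    apply mul_right_cancel₀ (lin_ne_zero hA)
    rw [h, hv]
    have hC := congrArg (C : ℝ → ℝ[X]) hκu
    simp only [C_mul] at hC
    simp only [lin, C_add, C_sub, C_mul, C_pow] at hC ⊢
    linear_combination (-(X + C B) * (X + C D) * (X ^ 3 + C A ^ 3)) * hC
  rw [hfac] at h3
  simp only [coeff_add, coeff_C_mul, coeff_X_pow, coeff_X, coeff_C] at h3
  norm_num [hκ0] at h3
  linarith

theorem eq_mul_of_add_of_pos {f : ℝ → ℝ} (hf0 : ∀ a, 0 < a → 0 < f a)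
    (hadd : ∀ a b, 0 < a → 0 < b → f (a + b) = f a + f b) (a : ℝ) (ha : 0 < a) :
    f a = f 1 * a := by
  have hmono : ∀ a b, 0 < a → a ≤ b → f a ≤ f b := by
    intro a b ha hab
    rcases hab.eq_or_lt with rfl | h
    · exact le_rfl
    have h1 := hadd a (b - a) ha (sub_pos.2 h)
    have h2 := hf0 _ (sub_pos.2 h)
    rw [add_sub_cancel] at h1
    linarith
  have hnat : ∀ (n : ℕ) (a : ℝ), 0 < a → f ((n + 1 : ℕ) * a) = (n + 1 : ℕ) * f a := by
    intro n a ha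
    induction n with
    | zero => simp
    | succ n ih =>
      rw [Nat.cast_succ, add_mul, one_mul, hadd _ _ (by positivity) ha, ih]
      push_cast
      ring
  have key : ∀ a b, 0 < a → 0 < b → f a ≤ f b * (a / b) := by
    intro a b ha hb
    by_contra! hlt
    obtain ⟨n, hn⟩ := exists_nat_gt (f b / (f a - f b * (a / b)))
    rw [div_lt_iff₀ (sub_pos.2 hlt)] at hn
    set m := ⌊((n + 1 : ℕ) : ℝ) * (a / b)⌋₊ with hm
    have h1 : ((n + 1 : ℕ) : ℝ) * (a / b) < (m + 1 : ℕ) := by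
      push_cast
      have := Nat.lt_floor_add_one (((n + 1 : ℕ) : ℝ) * (a / b))
      push_cast at this hm
      rwa [hm]
    have h2 : (m : ℝ) ≤ ((n + 1 : ℕ) : ℝ) * (a / b) := Nat.floor_le (by positivity)
    have h3 : ((n + 1 : ℕ) : ℝ) * a ≤ (m + 1 : ℕ) * b := by
      rw [← mul_div_assoc, div_lt_iff₀ hb] at h1
      exact h1.le
    have h4 := hmono _ _ (by positivity) h3
    rw [hnat n a ha, hnat m b hb] at h4
    have h5 := mul_le_mul_of_nonneg_right h2 (hf0 b hb).le
    push_cast at h4 h5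
    nlinarith [hf0 b hb]
  have h1 := key a 1 ha one_pos
  have h2 := key 1 a one_pos ha
  rw [div_one] at h1
  rw [mul_one_div, le_div_iff₀ ha] at h2
  exact le_antisymm h1 h2

theorem stmt_9 (Φ : Polynomial ℝ → Polynomial ℝ)
    (hmap : ∀ p ∈ Pset, Φ p ∈ Pset)
    (hsupp : ∀ p ∈ Pset, ∀ k : ℕ, 0 < (Φ p).coeff k ↔ 0 < p.coeff k)
    (hmul : ∀ p ∈ Pset, ∀ q ∈ Pset, Φ (p * q) = Φ p * Φ q) :
    ∃ γ : ℝ, 0 < γ ∧ ∀ a : ℝ, 0 < a → Φ (lin a) = lin (γ * a) := by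
  choose! f hf0 hf using exists_map_lin hmap hsupp
  refine ⟨f 1, hf0 1 one_pos, fun a ha => ?_⟩
  rw [hf a ha, eq_mul_of_add_of_pos hf0
    (fun _ _ hb hd => map_lin_add hmap hsupp hmul hf0 hf hb hd) a ha]
end

section
/- Let Ψ : ℳ → ℳ be multiplicative and degree-preserving, with Ψ[p] ∈ 𝒫 for every p ∈ 𝒫, and suppose the restriction of Ψ to 𝒫 is support-preserving and that Ψ[(X+1)/2] = (X+1)/2. Then for every a ∈ (−2,2), Ψ[(X²−aX+1)/(2−a)] = (X²−aX+1)/(2−a). -/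
open Polynomial

/-- `Mset` is the set of real polynomials `p` with `p(1) = 1` that are positive on the
positive reals. -/
def Mset : Set (Polynomial ℝ) := {p | p.eval 1 = 1 ∧ ∀ x : ℝ, 0 < x → 0 < p.eval x}

namespace Polynomial

/-- All coefficients are nonnegative. -/
def NonnegCoeffs (p : ℝ[X]) : Prop := ∀ k, 0 ≤ p.coeff k

namespace NonnegCoeffs

variable {p q : ℝ[X]}

theorem add (hp : NonnegCoeffs p) (hq : NonnegCoeffs q) : NonnegCoeffs (p + q) := fun k => by
  rw [coeff_add]; exact add_nonneg (hp k) (hq k)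

theorem mul (hp : NonnegCoeffs p) (hq : NonnegCoeffs q) : NonnegCoeffs (p * q) := fun k => by
  rw [coeff_mul]; exact Finset.sum_nonneg fun x _ => mul_nonneg (hp _) (hq _)

theorem const {c : ℝ} (hc : 0 ≤ c) : NonnegCoeffs (C c) := fun k => by
  rw [coeff_C]; split_ifs <;> simp [hc]

theorem one : NonnegCoeffs 1 := const zero_le_one

theorem X_pow (n : ℕ) : NonnegCoeffs (X ^ n) := fun k => by
  rw [coeff_X_pow]; split_ifs <;> simp

theorem X : NonnegCoeffs X := by simpa using X_pow 1

theorem expand (hp : NonnegCoeffs p) {n : ℕ} (hn : 0 < n) :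
    NonnegCoeffs (expand ℝ n p) := fun k => by
  rw [coeff_expand hn]; split_ifs
  exacts [hp _, le_rfl]

theorem eval_pos (hp : NonnegCoeffs p) {k : ℕ} (hk : 0 < p.coeff k) {x : ℝ} (hx : 0 < x) :
    0 < p.eval x := by
  rw [eval_eq_sum_range]
  refine Finset.sum_pos' (fun i _ => mul_nonneg (hp i) (by positivity)) ⟨k, ?_, by positivity⟩
  rw [Finset.mem_range, Nat.lt_succ_iff]
  exact le_natDegree_of_ne_zero hk.ne'

end NonnegCoeffs

/-- A quadratic `X² + sX + 1` without positive real roots divides a polynomial with nonnegative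
coefficients, with a cofactor of the same kind. -/
theorem exists_nonnegCoeffs_mul_quadratic {s : ℝ} (hs : -2 < s) :
    ∃ G : ℝ[X], NonnegCoeffs G ∧ 0 < G.coeff 0 ∧ NonnegCoeffs (G * (X ^ 2 + C s * X + 1)) := by
  have base : ∀ s : ℝ, 0 ≤ s → NonnegCoeffs (X ^ 2 + C s * X + 1) := fun s hs =>
    ((NonnegCoeffs.X_pow 2).add ((NonnegCoeffs.const hs).mul .X)).add .one
  have key : ∀ N : ℕ, ∀ s : ℝ, 2 ≤ 2 ^ N * (2 + s) → ∃ G : ℝ[X], NonnegCoeffs G ∧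
      0 < G.coeff 0 ∧ NonnegCoeffs (G * (X ^ 2 + C s * X + 1)) := by
    intro N
    induction N with
    | zero =>
      intro s h
      exact ⟨1, .one, by simp, by simpa using base s (by linarith)⟩
    | succ N ih =>
      intro s h
      rcases le_or_gt 0 s with h0 | h0
      · exact ⟨1, .one, by simp, by simpa using base s h0⟩
      · have h2 : 0 < 2 + s := by
          by_contra! hc
          have : (2 : ℝ) ^ (N + 1) * (2 + s) ≤ 0 :=
            mul_nonpos_of_nonneg_of_nonpos (by positivity) hc
          linarith
        have hN : (0 : ℝ) < 2 ^ N := by positivity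
        obtain ⟨G, hG, hG0, hGs⟩ := ih (2 - s ^ 2) (by
          rw [pow_succ] at h
          nlinarith [mul_pos hN h2, mul_pos (mul_pos hN h2) (neg_pos.2 h0)])
        refine ⟨(X ^ 2 + C (-s) * X + 1) * expand ℝ 2 G,
          (base _ (by linarith)).mul (hG.expand two_pos), ?_, ?_⟩
        · simpa [mul_coeff_zero, coeff_expand two_pos] using hG0
        · have h := hGs.expand two_pos
          convert h using 1
          simp only [map_mul, map_add, map_one, map_pow, expand_X, expand_C, map_sub, map_neg,
            map_ofNat]
          ring
  obtain ⟨N, hN⟩ := pow_unbounded_of_one_lt (2 / (2 + s)) (one_lt_two)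
  exact key N s (by
    rw [div_lt_iff₀ (by linarith)] at hN
    exact hN.le)

theorem coeff_mul_quartic (g : ℝ[X]) (hodd : ∀ k, Odd k → g.coeff k = 0) (e₀ e₁ e₂ e₃ e₄ : ℝ)
    {q : ℝ[X]} (hq : q = C e₄ * X ^ 4 + C e₃ * X ^ 3 + C e₂ * X ^ 2 + C e₁ * X + C e₀) :
    (g * q).coeff 0 = g.coeff 0 * e₀ ∧
    (g * q).coeff 1 = g.coeff 0 * e₁ ∧
    (g * q).coeff (g.natDegree + 3) = g.leadingCoeff * e₃ ∧
    (g * q).coeff (g.natDegree + 4) = g.leadingCoeff * e₄ := by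
  have hcoeff : ∀ k, (g * q).coeff k = e₄ * (if 4 ≤ k then g.coeff (k - 4) else 0) +
      e₃ * (if 3 ≤ k then g.coeff (k - 3) else 0) + e₂ * (if 2 ≤ k then g.coeff (k - 2) else 0) +
      e₁ * (if 1 ≤ k then g.coeff (k - 1) else 0) + e₀ * g.coeff k := by
    intro k
    have : g * q = C e₄ * (g * X ^ 4) + C e₃ * (g * X ^ 3) + C e₂ * (g * X ^ 2) +
        C e₁ * (g * X ^ 1) + C e₀ * g := by rw [hq]; ring
    rw [this]
    simp only [coeff_add, coeff_C_mul, coeff_mul_X_pow']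
  have hlt : ∀ k, g.natDegree < k → g.coeff k = 0 := fun k => coeff_eq_zero_of_natDegree_lt
  refine ⟨?_, ?_, ?_, ?_⟩
  · simp [hcoeff, mul_comm]
  · simp [hcoeff, mul_comm, hodd 1 odd_one]
  · have h1 : (if 4 ≤ g.natDegree + 3 then g.coeff (g.natDegree + 3 - 4) else 0) = 0 := by
      split_ifs with h
      · by_contra hne
        have h1 := hodd (g.natDegree + 3 - 4)
        have h2 := hodd g.natDegree
        have hev : ¬ Odd g.natDegree := fun ho => by
          have := h2 ho
          rw [coeff_natDegree, leadingCoeff_eq_zero] at this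
          exact hne (by simp [this])
        refine hne (h1 ?_)
        rw [Nat.not_odd_iff_even] at hev
        obtain ⟨m, hm⟩ := hev
        exact ⟨m - 1, by omega⟩
      · rfl
    rw [hcoeff, h1, if_pos (by omega), if_pos (by omega), if_pos (by omega),
      hlt (g.natDegree + 3 - 2) (by omega), hlt (g.natDegree + 3 - 1) (by omega),
      hlt (g.natDegree + 3) (by omega), Nat.add_sub_cancel, coeff_natDegree]
    ring
  · rw [hcoeff, if_pos (by omega), if_pos (by omega), if_pos (by omega), if_pos (by omega),
      hlt (g.natDegree + 4 - 3) (by omega), hlt (g.natDegree + 4 - 2) (by omega),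
      hlt (g.natDegree + 4 - 1) (by omega), hlt (g.natDegree + 4) (by omega),
      Nat.add_sub_cancel, coeff_natDegree]
    ring

end Polynomial

theorem Pset_subset_Mset : Pset ⊆ Mset := by
  rintro p ⟨hp, h1⟩
  refine ⟨h1, fun x hx => ?_⟩
  obtain ⟨k, hk⟩ : ∃ k, 0 < p.coeff k := by
    by_contra! h
    have : p = 0 := by
      ext k
      exact le_antisymm (h k) (hp k)
    simp [this] at h1
  exact NonnegCoeffs.eval_pos hp hk hx

theorem Mset_mul {p q : ℝ[X]} (hp : p ∈ Mset) (hq : q ∈ Mset) : p * q ∈ Mset :=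
  ⟨by rw [eval_mul, hp.1, hq.1, one_mul], fun x hx => by
    rw [eval_mul]; exact mul_pos (hp.2 x hx) (hq.2 x hx)⟩

theorem mem_Mset_of_mul_left {p q : ℝ[X]} (hp : p ∈ Mset) (hpq : p * q ∈ Mset) : q ∈ Mset := by
  refine ⟨?_, fun x hx => ?_⟩
  · simpa [hp.1] using hpq.1
  · have := hpq.2 x hx
    rw [eval_mul] at this
    exact (pos_iff_pos_of_mul_pos this).1 (hp.2 x hx)

theorem exists_even_mem_Pset {s : ℝ} (hs : -2 < s) :
    ∃ g ∈ Pset, (∀ k, Odd k → g.coeff k = 0) ∧ 0 < g.coeff 0 ∧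
      NonnegCoeffs (g * (X ^ 4 + C s * X ^ 2 + 1)) := by
  obtain ⟨G, hG, hG0, hGs⟩ := exists_nonnegCoeffs_mul_quadratic hs
  have h1 : 0 < G.eval 1 := hG.eval_pos hG0 one_pos
  have hc : NonnegCoeffs (C (G.eval 1)⁻¹) := .const (inv_nonneg.2 h1.le)
  refine ⟨C (G.eval 1)⁻¹ * expand ℝ 2 G, ⟨hc.mul (hG.expand two_pos), ?_⟩, ?_, ?_, ?_⟩
  · simp [expand_eval, h1.ne']
  · intro k hk
    rw [coeff_C_mul, coeff_expand two_pos, if_neg, mul_zero]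
    rwa [← even_iff_two_dvd, Nat.not_even_iff_odd]
  · rw [coeff_C_mul, coeff_expand two_pos]
    simpa using mul_pos (inv_pos.2 h1) hG0
  · convert hc.mul (hGs.expand two_pos) using 1
    simp only [map_mul, map_add, map_one, map_pow, expand_X, expand_C]
    ring

/-- The polynomial `X² - aX + 1`, normalized to take the value `1` at `1`. -/
noncomputable def quad (a : ℝ) : ℝ[X] := C (2 - a)⁻¹ * (X ^ 2 - C a * X + 1)

theorem quad_mem_Mset {a : ℝ} (ha : a ∈ Set.Ioo (-2 : ℝ) 2) : quad a ∈ Mset := by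
  have h2 : 0 < 2 - a := by linarith [ha.2]
  refine ⟨?_, fun x hx => ?_⟩
  · simp [quad]
    field_simp
    ring
  · simp only [quad, eval_mul, eval_C, eval_add, eval_sub, eval_pow, eval_X, eval_one]
    refine mul_pos (inv_pos.2 h2) ?_
    nlinarith [ha.1, sq_nonneg (x - 1), mul_pos hx h2]

theorem quad_mem_Pset {a : ℝ} (ha : a ≤ 0) : quad a ∈ Pset := by
  have h2 : 0 < 2 - a := by linarith
  refine ⟨?_, ?_⟩
  · have : quad a = C (2 - a)⁻¹ * (X ^ 2 + C (-a) * X + 1) := by rw [quad, map_neg]; ring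
    rw [this]
    exact NonnegCoeffs.mul (.const (inv_nonneg.2 h2.le))
      (((NonnegCoeffs.X_pow 2).add ((NonnegCoeffs.const (by linarith)).mul .X)).add .one)
  · simp [quad]
    field_simp
    ring

theorem natDegree_quad {a : ℝ} (ha : a < 2) : (quad a).natDegree = 2 := by
  have h2 : (2 - a)⁻¹ ≠ 0 := inv_ne_zero (by linarith)
  rw [quad, natDegree_C_mul h2]
  compute_degree!

theorem half_X_pow_add_one_mem_Pset (n : ℕ) : C 2⁻¹ * (X ^ n + 1) ∈ Pset := by
  refine ⟨?_, by simp; norm_num⟩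
  exact NonnegCoeffs.mul (.const (by norm_num)) ((NonnegCoeffs.X_pow n).add .one)

/-- A multiplicative, degree-preserving self-map of `Mset` which maps `Pset` to itself, preserves
supports there and fixes `(X + 1)/2`. -/
structure IsSupportPreservingHom (Ψ : ℝ[X] → ℝ[X]) : Prop where
  mapM : ∀ q ∈ Mset, Ψ q ∈ Mset
  map_mul_of_mem : ∀ p ∈ Mset, ∀ q ∈ Mset, Ψ (p * q) = Ψ p * Ψ q
  degree_eq : ∀ q ∈ Mset, (Ψ q).degree = q.degree
  mapP : ∀ p ∈ Pset, Ψ p ∈ Pset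
  coeff_pos_iff : ∀ p ∈ Pset, ∀ k : ℕ, 0 < (Ψ p).coeff k ↔ 0 < p.coeff k
  map_lin_one : Ψ (lin 1) = lin 1

namespace IsSupportPreservingHom

variable {Ψ : ℝ[X] → ℝ[X]}

theorem coeff_eq_zero (hΨ : IsSupportPreservingHom Ψ)
    {p : ℝ[X]} (hp : p ∈ Pset) {k : ℕ} (hk : p.coeff k = 0) :
    (Ψ p).coeff k = 0 :=
  le_antisymm (not_lt.1 fun h => ((hΨ.coeff_pos_iff p hp k).1 h).ne' hk) ((hΨ.mapP p hp).1 k)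

theorem natDegree_eq (hΨ : IsSupportPreservingHom Ψ)
    {p : ℝ[X]} (hp : p ∈ Mset) : (Ψ p).natDegree = p.natDegree :=
  natDegree_eq_of_degree_eq (hΨ.degree_eq p hp)

theorem map_quad_eq (hΨ : IsSupportPreservingHom Ψ) {a : ℝ} (ha : a ∈ Set.Ioo (-2 : ℝ) 2) :
    Ψ (quad a) = C ((Ψ (quad a)).coeff 2) * X ^ 2 + C ((Ψ (quad a)).coeff 1) * X +
      C ((Ψ (quad a)).coeff 0) := by
  apply eq_quadratic_of_degree_le_two
  apply degree_le_of_natDegree_le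
  rw [hΨ.natDegree_eq (quad_mem_Mset ha), natDegree_quad ha.2]

theorem coeff_sum (hΨ : IsSupportPreservingHom Ψ) {a : ℝ} (ha : a ∈ Set.Ioo (-2 : ℝ) 2) :
    (Ψ (quad a)).coeff 2 + (Ψ (quad a)).coeff 1 + (Ψ (quad a)).coeff 0 = 1 := by
  have h := (hΨ.mapM _ (quad_mem_Mset ha)).1
  rw [hΨ.map_quad_eq ha] at h
  simpa using h

theorem coeff_mul_quad_neg (hΨ : IsSupportPreservingHom Ψ)
    {a d : ℝ} (ha : a ∈ Set.Ioo (-2 : ℝ) 2) (hd : d ∈ Set.Ioo (-2 : ℝ) 2)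
    (had : a ≤ d) :
    0 < (Ψ (quad a)).coeff 0 * (Ψ (quad (-d))).coeff 0 ∧
    0 < (Ψ (quad a)).coeff 2 * (Ψ (quad (-d))).coeff 2 ∧
    (a < d → 0 < (Ψ (quad a)).coeff 0 * (Ψ (quad (-d))).coeff 1 +
      (Ψ (quad a)).coeff 1 * (Ψ (quad (-d))).coeff 0) ∧
    (a < d → 0 < (Ψ (quad a)).coeff 2 * (Ψ (quad (-d))).coeff 1 +
      (Ψ (quad a)).coeff 1 * (Ψ (quad (-d))).coeff 2) ∧
    (a = d → (Ψ (quad a)).coeff 0 * (Ψ (quad (-d))).coeff 1 +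
      (Ψ (quad a)).coeff 1 * (Ψ (quad (-d))).coeff 0 = 0) ∧
    (a = d → (Ψ (quad a)).coeff 2 * (Ψ (quad (-d))).coeff 1 +
      (Ψ (quad a)).coeff 1 * (Ψ (quad (-d))).coeff 2 = 0) := by
  obtain ⟨ha1, ha2⟩ := ha
  obtain ⟨hd1, hd2⟩ := hd
  have hda : -d ∈ Set.Ioo (-2 : ℝ) 2 := ⟨by linarith, by linarith⟩
  have hs : -2 < 2 - a * d := by
    nlinarith [mul_pos (sub_pos.2 ha2) (sub_pos.2 hd1), mul_pos (sub_pos.2 hd2) (sub_pos.2 ha1)]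
  obtain ⟨g, hg, hgodd, hg0, hgs⟩ := exists_even_mem_Pset hs
  set κ : ℝ := (2 - a)⁻¹ * (2 - -d)⁻¹ with hκ
  have hκ0 : 0 < κ := mul_pos (inv_pos.2 (by linarith)) (inv_pos.2 (by linarith))
  have hM := Mset_mul (quad_mem_Mset ⟨ha1, ha2⟩) (quad_mem_Mset hda)
  have hgM := Pset_subset_Mset hg
  have hP : g * (quad a * quad (-d)) ∈ Pset := by
    refine ⟨?_, (Mset_mul hgM hM).1⟩
    have : g * (quad a * quad (-d)) = C κ * (g * (X ^ 4 + C (2 - a * d) * X ^ 2 + 1) +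
        C (d - a) * (g * (X ^ 3 + X))) := by
      simp only [quad, hκ, map_mul, map_sub, map_neg, map_ofNat]
      ring
    rw [this]
    exact NonnegCoeffs.mul (.const hκ0.le) (hgs.add (.mul (.const (by linarith))
      (NonnegCoeffs.mul hg.1 ((NonnegCoeffs.X_pow 3).add .X))))
  have hquart : quad a * quad (-d) = C κ * X ^ 4 + C (κ * (d - a)) * X ^ 3 +
      C (κ * (2 - a * d)) * X ^ 2 + C (κ * (d - a)) * X + C κ := by
    simp only [quad, hκ, map_mul, map_sub, map_neg, map_ofNat]
    ring
  have hΨmul : Ψ (g * (quad a * quad (-d))) = Ψ g * (Ψ (quad a) * Ψ (quad (-d))) := by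
    rw [hΨ.map_mul_of_mem _ hgM _ hM, hΨ.map_mul_of_mem _ (quad_mem_Mset ⟨ha1, ha2⟩) _ (quad_mem_Mset hda)]
  have hpos := hΨ.coeff_pos_iff _ hP
  have hzero := fun k => hΨ.coeff_eq_zero hP (k := k)
  have hE0 : 0 < (Ψ g).coeff 0 := (hΨ.coeff_pos_iff g hg 0).2 hg0
  have hEdeg := hΨ.natDegree_eq hgM
  have hgl : 0 < g.leadingCoeff := lt_of_le_of_ne (hg.1 _) fun h => by
    rw [eq_comm, leadingCoeff_eq_zero] at h
    simp [h] at hg0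
  have hEl : 0 < (Ψ g).leadingCoeff := by
    rw [leadingCoeff, hEdeg]
    exact (hΨ.coeff_pos_iff g hg _).2 hgl
  have hp := hΨ.map_quad_eq ⟨ha1, ha2⟩
  have hp' := hΨ.map_quad_eq hda
  obtain ⟨s0, s1, s3, s4⟩ := coeff_mul_quartic g hgodd _ _ _ _ _ hquart
  generalize (Ψ (quad a)).coeff 0 = w at *
  generalize (Ψ (quad a)).coeff 1 = v at *
  generalize (Ψ (quad a)).coeff 2 = u at *
  generalize (Ψ (quad (-d))).coeff 0 = w' at *
  generalize (Ψ (quad (-d))).coeff 1 = v' at *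
  generalize (Ψ (quad (-d))).coeff 2 = u' at *
  have hquart' : Ψ (quad a) * Ψ (quad (-d)) = C (u * u') * X ^ 4 + C (u * v' + v * u') * X ^ 3 +
      C (u * w' + v * v' + w * u') * X ^ 2 + C (w * v' + v * w') * X + C (w * w') := by
    rw [hp, hp']
    simp only [map_mul, map_add]
    ring
  obtain ⟨t0, t1, t3, t4⟩ := coeff_mul_quartic (Ψ g)
    (fun k hk => hΨ.coeff_eq_zero hg (hgodd k hk)) _ _ _ _ _ hquart'
  rw [← hΨmul] at t0 t1 t3 t4
  rw [hEdeg] at t3 t4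
  refine ⟨?_, ?_, fun h => ?_, fun h => ?_, fun h => ?_, fun h => ?_⟩
  · refine pos_of_mul_pos_right ?_ hE0.le
    rw [← t0, hpos, s0]
    positivity
  · refine pos_of_mul_pos_right ?_ hEl.le
    rw [← t4, hpos, s4]
    positivity
  · refine pos_of_mul_pos_right ?_ hE0.le
    rw [← t1, hpos, s1]
    have := sub_pos.2 h
    positivity
  · refine pos_of_mul_pos_right ?_ hEl.le
    rw [← t3, hpos, s3]
    have := sub_pos.2 h
    positivity
  · refine (mul_eq_zero.1 ?_).resolve_left hE0.ne'
    rw [← t1]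
    exact hzero _ (by rw [s1, h]; simp)
  · refine (mul_eq_zero.1 ?_).resolve_left hEl.ne'
    rw [← t3]
    exact hzero _ (by rw [s3, h]; simp)

theorem coeff_zero_and_two_pos (hΨ : IsSupportPreservingHom Ψ)
    {a : ℝ} (ha : a ∈ Set.Ioo (-2 : ℝ) 2) :
    0 < (Ψ (quad a)).coeff 0 ∧ 0 < (Ψ (quad a)).coeff 2 := by
  have key : ∀ b ≤ 0, 0 < (Ψ (quad b)).coeff 0 ∧ 0 < (Ψ (quad b)).coeff 2 := by
    intro b hb
    have h2 : 0 < 2 - b := by linarith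
    rw [hΨ.coeff_pos_iff _ (quad_mem_Pset hb), hΨ.coeff_pos_iff _ (quad_mem_Pset hb)]
    simp [quad, coeff_X, coeff_one, h2]
  rcases le_total a 0 with h | h
  · exact key a h
  · obtain ⟨h0, h2, -⟩ := hΨ.coeff_mul_quad_neg ha ha le_rfl
    obtain ⟨k0, k2⟩ := key (-a) (by linarith)
    exact ⟨pos_of_mul_pos_left h0 k0.le, pos_of_mul_pos_left h2 k2.le⟩

/-- Writing `Ψ (quad a) = uX² - vX + w`, the ratios `v / w` and `v / u` are odd functions of
`a`. -/
theorem ratio_neg (hΨ : IsSupportPreservingHom Ψ)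
    {a : ℝ} (ha : a ∈ Set.Ioo (-2 : ℝ) 2) {i : ℕ} (hi : i = 0 ∨ i = 2) :
    -(Ψ (quad (-a))).coeff 1 / (Ψ (quad (-a))).coeff i =
      -(-(Ψ (quad a)).coeff 1 / (Ψ (quad a)).coeff i) := by
  obtain ⟨-, -, -, -, h0, h2⟩ := hΨ.coeff_mul_quad_neg ha ha le_rfl
  have ha' : -a ∈ Set.Ioo (-2 : ℝ) 2 := ⟨by linarith [ha.2], by linarith [ha.1]⟩
  obtain ⟨p0, p2⟩ := hΨ.coeff_zero_and_two_pos ha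
  obtain ⟨n0, n2⟩ := hΨ.coeff_zero_and_two_pos ha'
  rcases hi with rfl | rfl
  · rw [neg_div, neg_div, neg_neg, neg_eq_iff_add_eq_zero, div_add_div _ _ n0.ne' p0.ne',
      div_eq_zero_iff]
    left; linarith [h0 rfl]
  · rw [neg_div, neg_div, neg_neg, neg_eq_iff_add_eq_zero, div_add_div _ _ n2.ne' p2.ne',
      div_eq_zero_iff]
    left; linarith [h2 rfl]

theorem strictMonoOn_ratio (hΨ : IsSupportPreservingHom Ψ) {i : ℕ} (hi : i = 0 ∨ i = 2) :
    StrictMonoOn (fun a => -(Ψ (quad a)).coeff 1 / (Ψ (quad a)).coeff i)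
      (Set.Ioo (-2 : ℝ) 2) := by
  intro a ha d hd had
  obtain ⟨-, -, h0, h2, -, -⟩ := hΨ.coeff_mul_quad_neg ha hd had.le
  have hd' : -d ∈ Set.Ioo (-2 : ℝ) 2 := ⟨by linarith [hd.2], by linarith [hd.1]⟩
  obtain ⟨p0, p2⟩ := hΨ.coeff_zero_and_two_pos ha
  obtain ⟨n0, n2⟩ := hΨ.coeff_zero_and_two_pos hd'
  have hneg := hΨ.ratio_neg hd hi
  rw [← sub_pos]
  dsimp only
  rw [neg_eq_iff_eq_neg.1 hneg.symm]
  rcases hi with rfl | rfl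
  · refine (div_pos (h0 had) (mul_pos p0 n0)).trans_eq ?_
    field_simp
    ring
  · refine (div_pos (h2 had) (mul_pos p2 n2)).trans_eq ?_
    field_simp
    ring

end IsSupportPreservingHom

theorem eq_of_strictMonoOn_of_dense_fixedPoints {f : ℝ → ℝ} {x y : ℝ}
    (hf : StrictMonoOn f (Set.Ioo x y))
    (hfix : ∀ s t, x ≤ s → t ≤ y → s < t → ∃ a ∈ Set.Ioo s t, f a = a)
    {a : ℝ} (ha : a ∈ Set.Ioo x y) : f a = a := by
  rcases lt_trichotomy (f a) a with h | h | h
  · obtain ⟨d, ⟨hd1, hd2⟩, hd⟩ := hfix (max (f a) x) a (le_max_right _ _) ha.2.le (max_lt h ha.1)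
    have := hf ⟨(le_max_right _ _).trans_lt hd1, hd2.trans ha.2⟩ ha hd2
    linarith [(le_max_left (f a) x).trans_lt hd1]
  · exact h
  · obtain ⟨d, ⟨hd1, hd2⟩, hd⟩ := hfix a (min (f a) y) ha.1.le (min_le_right _ _) (lt_min h ha.2)
    have := hf ha ⟨ha.1.trans hd1, hd2.trans_le (min_le_right _ _)⟩ hd1
    linarith [hd2.trans_le (min_le_left (f a) y)]

theorem eq_self_of_strictMonoOn_finite {s : Set ℝ} (hs : s.Finite) {f : ℝ → ℝ}
    (hf : StrictMonoOn f s) (hmaps : Set.MapsTo f s s) {a : ℝ} (ha : a ∈ s) : f a = a := by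
  have : Finite s := hs
  have hmono : StrictMono (hmaps.restrict f s s) := fun x y hxy => hf x.2 y.2 hxy
  exact congrArg Subtype.val
    (le_antisymm (hmono.apply_le (x := ⟨a, ha⟩)) (hmono.le_apply (x := ⟨a, ha⟩)))

theorem pow_eq_neg_one_of_quadratic_dvd {u v w : ℝ} {n : ℕ}
    (h : C u * X ^ 2 + C v * X + C w ∣ (X ^ n + 1 : ℝ[X])) {z : ℂ}
    (hz : u * z ^ 2 + v * z + w = 0) : z ^ n = -1 := by
  obtain ⟨q, hq⟩ := h
  have := congrArg (aeval z) hq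
  simp only [map_add, map_mul, map_pow, aeval_X, aeval_C, map_one, Complex.coe_algebraMap, hz,
    zero_mul] at this
  exact eq_neg_of_add_eq_zero_left this

theorem norm_eq_one_of_pow_eq_neg_one {n : ℕ} (hn : n ≠ 0) {z : ℂ} (hz : z ^ n = -1) :
    ‖z‖ = 1 := by
  refine (pow_eq_one_iff_of_nonneg (norm_nonneg z) hn).1 ?_
  rw [← norm_pow, hz, norm_neg, norm_one]

theorem coeff_eq_of_quadratic_dvd {u v w : ℝ} (hu : 0 < u) (hw : 0 < w) {n : ℕ} (hn : n ≠ 0)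
    (h : C u * X ^ 2 + C v * X + C w ∣ (X ^ n + 1 : ℝ[X])) : u = w := by
  have hu' : (u : ℂ) ≠ 0 := by exact_mod_cast hu.ne'
  obtain ⟨s, hs⟩ := IsAlgClosed.exists_eq_mul_self (discrim (u : ℂ) v w)
  obtain ⟨z, hz⟩ := exists_quadratic_eq_zero hu' ⟨s, hs⟩
  have hz1 := norm_eq_one_of_pow_eq_neg_one hn
    (pow_eq_neg_one_of_quadratic_dvd h (z := z) (by rw [← hz]; ring))
  have hz2 := norm_eq_one_of_pow_eq_neg_one hn
    (pow_eq_neg_one_of_quadratic_dvd h (z := -v / u - z) (by rw [← hz]; field_simp; ring))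
  have hprod : z * (-v / u - z) = ((w / u : ℝ) : ℂ) := by
    push_cast
    field_simp
    linear_combination -hz
  have := congrArg norm hprod
  rw [norm_mul, hz1, hz2, Complex.norm_real, Real.norm_of_nonneg (by positivity), one_mul,
    eq_div_iff hu.ne', one_mul] at this
  exact this

theorem finite_setOf_quadratic_dvd {n : ℕ} (hn : 0 < n) :
    {b : ℝ | (X ^ 2 - C b * X + 1 : ℝ[X]) ∣ X ^ n + 1}.Finite := by
  refine ((nthRoots n (-1 : ℂ)).toFinset.finite_toSet.image
    fun z => (z + z⁻¹).re).subset fun b hb => ?_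
  obtain ⟨s, hs⟩ := IsAlgClosed.exists_eq_mul_self (discrim (1 : ℂ) (-b) 1)
  obtain ⟨z, hz⟩ := exists_quadratic_eq_zero one_ne_zero ⟨s, hs⟩
  have hzn : z ^ n = -1 := by
    refine pow_eq_neg_one_of_quadratic_dvd (u := 1) (v := -b) (w := 1) ?_ ?_
    · convert hb.out using 1
      simp only [map_one, map_neg]
      ring
    · rw [← hz]
      push_cast
      ring
  have hz0 : z ≠ 0 := by
    rintro rfl
    simp at hz
  refine ⟨z, by simpa [mem_nthRoots hn] using hzn, ?_⟩
  have : z + z⁻¹ = (b : ℂ) := by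
    field_simp
    linear_combination hz
  simp [this]

theorem exists_odd_div_odd_btwn {α β : ℝ} (hα : 0 ≤ α) (h : α < β) :
    ∃ j m : ℕ, ((2 * j + 1 : ℝ) / (2 * m + 1)) ∈ Set.Ioo α β := by
  obtain ⟨m, hm⟩ := exists_nat_gt (1 / (β - α))
  have hβα := sub_pos.2 h
  rw [div_lt_iff₀ hβα] at hm
  have hm0 : (0 : ℝ) < 2 * m + 1 := by positivity
  have h0 : 0 ≤ ((2 * m + 1) * α + 1) / 2 := by positivity
  refine ⟨⌊((2 * m + 1) * α + 1) / 2⌋₊, m, ?_, ?_⟩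
  · rw [lt_div_iff₀ hm0]
    linarith [Nat.lt_floor_add_one (((2 * m + 1) * α + 1) / 2)]
  · rw [div_lt_iff₀ hm0]
    linarith [Nat.floor_le h0]

theorem exists_quadratic_dvd_X_pow_add_one {s t : ℝ} (hs : -2 ≤ s) (ht : t ≤ 2) (hst : s < t) :
    ∃ a ∈ Set.Ioo s t, ∃ n : ℕ, Odd n ∧ (X ^ 2 - C a * X + 1 : ℝ[X]) ∣ X ^ n + 1 := by
  have hπ := Real.pi_pos
  have hlt : Real.arccos (t / 2) / Real.pi < Real.arccos (s / 2) / Real.pi := by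
    exact div_lt_div_of_pos_right (Real.strictAntiOn_arccos ⟨by linarith, by linarith⟩
      ⟨by linarith, by linarith⟩ (by linarith)) hπ
  obtain ⟨j, m, h1, h2⟩ :=
    exists_odd_div_odd_btwn (div_nonneg (Real.arccos_nonneg _) hπ.le) hlt
  set θ : ℝ := (2 * j + 1 : ℝ) / (2 * m + 1) * Real.pi with hθ
  have h1' : Real.arccos (t / 2) < θ := (div_lt_iff₀ hπ).1 h1
  have h2' : θ < Real.arccos (s / 2) := (lt_div_iff₀ hπ).1 h2
  have hθ0 : 0 < θ := by positivity
  have hθπ : θ < Real.pi := h2'.trans_le (Real.arccos_le_pi _)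
  refine ⟨2 * Real.cos θ, ⟨?_, ?_⟩, 2 * m + 1, ⟨m, rfl⟩, ?_⟩
  · have := Real.strictAntiOn_cos ⟨hθ0.le, hθπ.le⟩
      ⟨Real.arccos_nonneg _, Real.arccos_le_pi _⟩ h2'
    rw [Real.cos_arccos (by linarith) (by linarith)] at this
    linarith
  · have := Real.strictAntiOn_cos ⟨Real.arccos_nonneg _, Real.arccos_le_pi _⟩
      ⟨hθ0.le, hθπ.le⟩ h1'
    rw [Real.cos_arccos (by linarith) (by linarith)] at this
    linarith
  · have hroot : aeval (Complex.exp (θ * Complex.I)) (X ^ (2 * m + 1) + 1 : ℝ[X]) = 0 := by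
      have harg : ((2 * m + 1 : ℕ) : ℂ) * (θ * Complex.I) =
          Real.pi * Complex.I + j * (2 * Real.pi * Complex.I) := by
        have : (2 * m + 1 : ℂ) ≠ 0 := by exact_mod_cast (by omega : 2 * m + 1 ≠ 0)
        rw [hθ]
        push_cast
        field_simp
        ring
      simp only [map_add, map_pow, aeval_X, map_one]
      rw [← Complex.exp_nat_mul, harg, Complex.exp_add, Complex.exp_nat_mul_two_pi_mul_I,
        Complex.exp_pi_mul_I]
      norm_num
    have him : (Complex.exp (θ * Complex.I)).im ≠ 0 := by
      rw [Complex.exp_ofReal_mul_I_im]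
      exact (Real.sin_pos_of_pos_of_lt_pi hθ0 hθπ).ne'
    have := quadratic_dvd_of_aeval_eq_zero_im_ne_zero _ hroot him
    rwa [Complex.exp_ofReal_mul_I_re, Complex.norm_exp_ofReal_mul_I, one_pow, map_one] at this

namespace IsSupportPreservingHom

variable {Ψ : ℝ[X] → ℝ[X]}

theorem map_X_pow_add_one (hΨ : IsSupportPreservingHom Ψ) {n : ℕ} (hn : Odd n) :
    Ψ (C 2⁻¹ * (X ^ n + 1)) = C 2⁻¹ * (X ^ n + 1) := by
  have hn0 : n ≠ 0 := hn.pos.ne'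
  have hP := half_X_pow_add_one_mem_Pset n
  obtain ⟨r, hr⟩ : (X + 1 : ℝ[X]) ∣ X ^ n + 1 := by
    simpa using hn.add_dvd_pow_add_pow (X : ℝ[X]) 1
  have hlin : lin 1 = C 2⁻¹ * (X + 1) := by
    rw [lin, map_one]
    norm_num
  have hlinM : lin 1 ∈ Mset := by
    have := Pset_subset_Mset (half_X_pow_add_one_mem_Pset 1)
    rwa [pow_one, ← hlin] at this
  have hfac : C 2⁻¹ * (X ^ n + 1) = lin 1 * r := by rw [hr, hlin, mul_assoc]
  have hrM : r ∈ Mset := mem_Mset_of_mul_left hlinM (hfac ▸ Pset_subset_Mset hP)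
  have hroot : (Ψ (C 2⁻¹ * (X ^ n + 1))).eval (-1) = 0 := by
    rw [hfac, hΨ.map_mul_of_mem _ hlinM _ hrM, hΨ.map_lin_one, hlin]
    simp
  set q := Ψ (C 2⁻¹ * (X ^ n + 1)) with hq
  have hshape : q = C (q.coeff n) * X ^ n + C (q.coeff 0) := by
    ext k
    by_cases hk : k = n
    · subst hk
      simp [hn0, coeff_C]
    · by_cases hk0 : k = 0
      · subst hk0
        simp [coeff_X_pow, hn0.symm]
      · have : q.coeff k = 0 := hΨ.coeff_eq_zero hP (by simp [coeff_X_pow, coeff_one, hk, hk0])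
        simp [this, coeff_X_pow, coeff_C, hk, hk0]
  have h1 := (hΨ.mapP _ hP).2
  rw [← hq, hshape] at h1
  rw [hshape] at hroot
  simp only [eval_add, eval_mul, eval_C, eval_pow, eval_X, one_pow, hn.neg_one_pow] at h1 hroot
  rw [hshape, show q.coeff n = 2⁻¹ by linarith, show q.coeff 0 = 2⁻¹ by linarith]
  ring

theorem map_quad_dvd (hΨ : IsSupportPreservingHom Ψ)
    {a : ℝ} (ha : a ∈ Set.Ioo (-2 : ℝ) 2) {n : ℕ} (hn : Odd n)
    (h : (X ^ 2 - C a * X + 1 : ℝ[X]) ∣ X ^ n + 1) : Ψ (quad a) ∣ X ^ n + 1 := by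
  have h2 : (2 - a)⁻¹ ≠ 0 := inv_ne_zero (by linarith [ha.2])
  have hu2 : IsUnit (C (2⁻¹ : ℝ)) := isUnit_C.2 (by norm_num)
  obtain ⟨r, hr⟩ : quad a ∣ C 2⁻¹ * (X ^ n + 1) := by
    rw [quad, hu2.dvd_mul_left]
    exact (isUnit_C.2 (isUnit_iff_ne_zero.2 h2)).mul_left_dvd.2 h
  have hrM : r ∈ Mset := mem_Mset_of_mul_left (quad_mem_Mset ha)
    (hr ▸ Pset_subset_Mset (half_X_pow_add_one_mem_Pset n))
  rw [← hu2.dvd_mul_left, ← hΨ.map_X_pow_add_one hn, hr,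
    hΨ.map_mul_of_mem _ (quad_mem_Mset ha) _ hrM]
  exact dvd_mul_right _ _

theorem coeff_two_eq_coeff_zero (hΨ : IsSupportPreservingHom Ψ)
    {a : ℝ} (ha : a ∈ Set.Ioo (-2 : ℝ) 2) {n : ℕ} (hn : Odd n)
    (h : (X ^ 2 - C a * X + 1 : ℝ[X]) ∣ X ^ n + 1) :
    (Ψ (quad a)).coeff 2 = (Ψ (quad a)).coeff 0 := by
  obtain ⟨h0, h2⟩ := hΨ.coeff_zero_and_two_pos ha
  refine coeff_eq_of_quadratic_dvd h2 h0 hn.pos.ne' (v := (Ψ (quad a)).coeff 1) ?_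
  rw [← hΨ.map_quad_eq ha]
  exact hΨ.map_quad_dvd ha hn h

/-- If `X² - aX + 1` divides `X ^ n + 1` with `n` odd, then so does its image under `Ψ`; as there
are finitely many such `a`, monotonicity forces the polynomial to be fixed. -/
theorem ratio_eq_of_dvd (hΨ : IsSupportPreservingHom Ψ)
    {a : ℝ} (ha : a ∈ Set.Ioo (-2 : ℝ) 2) {n : ℕ} (hn : Odd n)
    (h : (X ^ 2 - C a * X + 1 : ℝ[X]) ∣ X ^ n + 1) :
    -(Ψ (quad a)).coeff 1 / (Ψ (quad a)).coeff 0 = a := by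
  refine eq_self_of_strictMonoOn_finite
    (f := fun a => -(Ψ (quad a)).coeff 1 / (Ψ (quad a)).coeff 0)
    (s := {b | (X ^ 2 - C b * X + 1 : ℝ[X]) ∣ X ^ n + 1} ∩ Set.Ioo (-2 : ℝ) 2)
    ((finite_setOf_quadratic_dvd hn.pos).subset Set.inter_subset_left)
    ((hΨ.strictMonoOn_ratio (.inl rfl)).mono Set.inter_subset_right) ?_ ⟨h, ha⟩
  rintro b ⟨hbn, hb⟩
  obtain ⟨h0, h2⟩ := hΨ.coeff_zero_and_two_pos hb
  have hb' : -b ∈ Set.Ioo (-2 : ℝ) 2 := ⟨by linarith [hb.2], by linarith [hb.1]⟩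
  obtain ⟨n0, n2⟩ := hΨ.coeff_zero_and_two_pos hb'
  have heq := hΨ.coeff_two_eq_coeff_zero hb hn hbn
  have hsum := hΨ.coeff_sum hb
  have hsum' := hΨ.coeff_sum hb'
  have hneg0 := hΨ.ratio_neg hb (.inl rfl)
  have hneg2 := hΨ.ratio_neg hb (.inr rfl)
  have hdvd := hΨ.map_quad_dvd hb hn hbn
  rw [hΨ.map_quad_eq hb] at hdvd
  rw [heq] at hneg2 hsum hdvd
  dsimp only
  generalize (Ψ (quad b)).coeff 0 = w at *
  generalize (Ψ (quad b)).coeff 1 = v at *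
  generalize (Ψ (quad (-b))).coeff 0 = w' at *
  generalize (Ψ (quad (-b))).coeff 1 = v' at *
  generalize (Ψ (quad (-b))).coeff 2 = u' at *
  obtain ⟨r, hr⟩ : ∃ r, r = -v / w := ⟨_, rfl⟩
  rw [← hr] at hneg0 hneg2 ⊢
  have hv : v = -(r * w) := by
    rw [hr]
    field_simp
  subst hv
  refine ⟨?_, ?_, ?_⟩
  · refine (Dvd.intro_left (C w) ?_ : _ ∣ C w * X ^ 2 + C (-(r * w)) * X + C w).trans hdvd
    simp only [map_mul, map_neg]
    ring
  · have e0 : v' = r * w' := by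
      field_simp at hneg0
      linarith
    have e2 : v' = r * u' := by
      field_simp at hneg2
      linarith
    by_contra! hr2
    have hr0 : r ≠ 0 := by linarith
    have : w' = u' := mul_left_cancel₀ hr0 (e0.symm.trans e2)
    subst this
    nlinarith
  · nlinarith

theorem ratio_eq (hΨ : IsSupportPreservingHom Ψ)
    {a : ℝ} (ha : a ∈ Set.Ioo (-2 : ℝ) 2) {i : ℕ} (hi : i = 0 ∨ i = 2) :
    -(Ψ (quad a)).coeff 1 / (Ψ (quad a)).coeff i = a := by
  refine eq_of_strictMonoOn_of_dense_fixedPoints (hΨ.strictMonoOn_ratio hi)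
    (fun s t hs ht hst => ?_) ha
  obtain ⟨d, hd, n, hn, hdvd⟩ := exists_quadratic_dvd_X_pow_add_one hs ht hst
  have hd2 : d ∈ Set.Ioo (-2 : ℝ) 2 := ⟨hs.trans_lt hd.1, hd.2.trans_le ht⟩
  refine ⟨d, hd, ?_⟩
  rcases hi with rfl | rfl
  · exact hΨ.ratio_eq_of_dvd hd2 hn hdvd
  · rw [hΨ.coeff_two_eq_coeff_zero hd2 hn hdvd]
    exact hΨ.ratio_eq_of_dvd hd2 hn hdvd

theorem map_quad_of_coeff_eq (hΨ : IsSupportPreservingHom Ψ) {a : ℝ} (ha : a ∈ Set.Ioo (-2 : ℝ) 2)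
    (h : (Ψ (quad a)).coeff 2 = (Ψ (quad a)).coeff 0) : Ψ (quad a) = quad a := by
  have h2 : 2 - a ≠ 0 := by linarith [ha.2]
  have hsum := hΨ.coeff_sum ha
  have h0 := hΨ.ratio_eq ha (.inl rfl)
  rw [div_eq_iff (hΨ.coeff_zero_and_two_pos ha).1.ne', neg_eq_iff_eq_neg] at h0
  rw [h, h0] at hsum
  have hw : (Ψ (quad a)).coeff 0 = (2 - a)⁻¹ := eq_inv_of_mul_eq_one_left (by linarith)
  rw [hΨ.map_quad_eq ha, h, h0, hw, quad]
  simp only [map_mul, map_neg]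
  ring

theorem map_quad_of_ne_zero (hΨ : IsSupportPreservingHom Ψ)
    {a : ℝ} (ha : a ∈ Set.Ioo (-2 : ℝ) 2) (ha0 : a ≠ 0) :
    Ψ (quad a) = quad a := by
  refine hΨ.map_quad_of_coeff_eq ha ?_
  have h0 := hΨ.ratio_eq ha (.inl rfl)
  have h2 := hΨ.ratio_eq ha (.inr rfl)
  rw [div_eq_iff (hΨ.coeff_zero_and_two_pos ha).1.ne'] at h0
  rw [div_eq_iff (hΨ.coeff_zero_and_two_pos ha).2.ne'] at h2
  exact mul_left_cancel₀ ha0 (h2.symm.trans h0)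

theorem map_quad_zero (hΨ : IsSupportPreservingHom Ψ) : Ψ (quad 0) = quad 0 := by
  have h0 : (0 : ℝ) ∈ Set.Ioo (-2 : ℝ) 2 := by norm_num
  have h3 : √3 ∈ Set.Ioo (-2 : ℝ) 2 := by
    refine ⟨by linarith [Real.sqrt_nonneg 3], ?_⟩
    rw [Real.sqrt_lt' two_pos]
    norm_num
  have h3' : -√3 ∈ Set.Ioo (-2 : ℝ) 2 := ⟨by linarith [h3.2], by linarith [h3.1]⟩
  have h30 : √3 ≠ 0 := by positivity
  have hsq : √3 * √3 = 3 := Real.mul_self_sqrt (by norm_num)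
  have hprod : quad √3 * quad (-√3) = X ^ 4 - X ^ 2 + 1 := by
    have hc : (C (2 - √3)⁻¹ * C (2 - -√3)⁻¹ : ℝ[X]) = 1 := by
      rw [← C_mul, ← mul_inv, show (2 - √3) * (2 - -√3) = 1 by linear_combination -hsq, inv_one,
        C_1]
    have hs : (C √3 * C √3 : ℝ[X]) = 3 := by
      rw [← C_mul, hsq]
      rfl
    simp only [quad, map_neg]
    linear_combination ((X ^ 2 + 1) ^ 2 - C √3 * C √3 * X ^ 2) * hc - X ^ 2 * hs
  have hM := Mset_mul (quad_mem_Mset h3) (quad_mem_Mset h3')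
  have hX6 : C 2⁻¹ * (X ^ 6 + 1) = quad 0 * (quad √3 * quad (-√3)) := by
    rw [hprod, quad]
    simp only [map_zero, sub_zero]
    ring
  have hmap : Ψ (C 2⁻¹ * (X ^ 6 + 1)) = Ψ (quad 0) * (X ^ 4 - X ^ 2 + 1) := by
    rw [hX6, hΨ.map_mul_of_mem _ (quad_mem_Mset h0) _ hM,
      hΨ.map_mul_of_mem _ (quad_mem_Mset h3) _ (quad_mem_Mset h3'),
      hΨ.map_quad_of_ne_zero h3 h30, hΨ.map_quad_of_ne_zero h3' (neg_ne_zero.2 h30), hprod]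
  have hcoeff := hΨ.coeff_eq_zero (half_X_pow_add_one_mem_Pset 6) (k := 2)
    (by simp [coeff_X_pow, coeff_one])
  refine hΨ.map_quad_of_coeff_eq h0 ?_
  rw [hmap] at hcoeff
  simp only [mul_add, mul_sub, mul_one, coeff_add, coeff_sub, coeff_mul_X_pow'] at hcoeff
  norm_num at hcoeff
  linarith

end IsSupportPreservingHom

theorem stmt_14 (Ψ : Polynomial ℝ → Polynomial ℝ)
    (hmapM : ∀ q ∈ Mset, Ψ q ∈ Mset)
    (hmul : ∀ p ∈ Mset, ∀ q ∈ Mset, Ψ (p * q) = Ψ p * Ψ q)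
    (hdeg : ∀ q ∈ Mset, (Ψ q).degree = q.degree)
    (hmapP : ∀ p ∈ Pset, Ψ p ∈ Pset)
    (hsupp : ∀ p ∈ Pset, ∀ k : ℕ, 0 < (Ψ p).coeff k ↔ 0 < p.coeff k)
    (hfix : Ψ (lin 1) = lin 1) :
    ∀ a : ℝ, a ∈ Set.Ioo (-2 : ℝ) 2 →
      Ψ (C (2 - a)⁻¹ * (X ^ 2 - C a * X + 1)) =
        C (2 - a)⁻¹ * (X ^ 2 - C a * X + 1) := by
  intro a ha
  have hΨ : IsSupportPreservingHom Ψ := ⟨hmapM, hmul, hdeg, hmapP, hsupp, hfix⟩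
  rcases eq_or_ne a 0 with rfl | ha0
  · exact hΨ.map_quad_zero
  · exact hΨ.map_quad_of_ne_zero ha ha0
end

section
/- Let p, p' ∈ 𝒫 with deg p' ≤ deg p and with the constant coefficient of p nonzero, and suppose p ≠ p'. Then there exist q ∈ ℳ and ε > 0 such that: q·p ∈ 𝒫; q·p' ∉ 𝒫; and every q' ∈ ℳ with deg q' = deg q and |coeff_k(q') − coeff_k(q)| < ε for all k satisfies q'·p ∈ 𝒫. (That is, q lies in the interior of S_p but not in S_{p'}.) -/
open Polynomial

lemma eval_pos_of_coeff_nonneg {r : ℝ[X]} (hr : ∀ k, 0 ≤ r.coeff k) (h0 : 0 < r.coeff 0)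
    {x : ℝ} (hx : 0 < x) : 0 < r.eval x := by
  rw [eval_eq_sum_range]
  refine lt_of_lt_of_le (b := r.coeff 0 * x ^ 0) (by simpa using h0) ?_
  exact Finset.single_le_sum (f := fun i => r.coeff i * x ^ i)
    (fun i _ => mul_nonneg (hr i) (pow_nonneg hx.le i)) (by simp)

lemma coeff_mul_coeff_le_coeff_mul {g r : ℝ[X]} (hg : ∀ k, 0 ≤ g.coeff k)
    (hr : ∀ k, 0 ≤ r.coeff k) (i k : ℕ) :
    g.coeff i * r.coeff k ≤ (g * r).coeff (i + k) := by
  rw [coeff_mul]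
  exact Finset.single_le_sum (f := fun x : ℕ × ℕ => g.coeff x.1 * r.coeff x.2)
    (fun x _ => mul_nonneg (hg x.1) (hr x.2)) (a := (i, k)) (by simp)

lemma coeff_mul_nonneg {g r : ℝ[X]} (hg : ∀ k, 0 ≤ g.coeff k)
    (hr : ∀ k, 0 ≤ r.coeff k) (j : ℕ) : 0 ≤ (g * r).coeff j := by
  rw [coeff_mul]
  exact Finset.sum_nonneg fun x _ => mul_nonneg (hg x.1) (hr x.2)

lemma sum_coeff_range_le_one {r : ℝ[X]} (hr : r ∈ Pset) (m : ℕ) :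
    ∑ k ∈ Finset.range m, r.coeff k ≤ 1 := by
  have h : r.eval 1 = ∑ k ∈ Finset.range (m + (r.natDegree + 1)), r.coeff k := by
    rw [eval_eq_sum_range' (n := m + (r.natDegree + 1)) (by omega)]
    simp
  rw [← hr.2, h]
  exact Finset.sum_le_sum_of_subset_of_nonneg (by simp) fun i _ _ => hr.1 i

lemma abs_coeff_mul_le {g r : ℝ[X]} (hr : r ∈ Pset) {ε : ℝ}
    (hg : ∀ k, |g.coeff k| ≤ ε) (j : ℕ) : |(g * r).coeff j| ≤ ε := by
  have hε : 0 ≤ ε := (abs_nonneg _).trans (hg 0)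
  rw [mul_comm, coeff_mul, Finset.Nat.sum_antidiagonal_eq_sum_range_succ_mk]
  calc |∑ k ∈ Finset.range j.succ, r.coeff k * g.coeff (j - k)|
      ≤ ∑ k ∈ Finset.range j.succ, |r.coeff k * g.coeff (j - k)| :=
        Finset.abs_sum_le_sum_abs _ _
    _ ≤ ∑ k ∈ Finset.range j.succ, r.coeff k * ε := by
        refine Finset.sum_le_sum fun k _ => ?_
        rw [abs_mul, abs_of_nonneg (hr.1 k)]
        exact mul_le_mul_of_nonneg_left (hg _) (hr.1 k)
    _ = (∑ k ∈ Finset.range j.succ, r.coeff k) * ε := by rw [Finset.sum_mul]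
    _ ≤ 1 * ε := mul_le_mul_of_nonneg_right (sum_coeff_range_le_one hr _) hε
    _ = ε := one_mul ε

lemma exists_abs_coeff_le (r : ℝ[X]) : ∃ B : ℝ, 0 ≤ B ∧ ∀ j, |r.coeff j| ≤ B := by
  refine ⟨∑ i ∈ r.support, |r.coeff i|, Finset.sum_nonneg fun i _ => abs_nonneg _, fun j => ?_⟩
  by_cases hj : j ∈ r.support
  · exact Finset.single_le_sum (f := fun i => |r.coeff i|) (fun i _ => abs_nonneg _) hj
  · rw [notMem_support_iff.mp hj, abs_zero]
    exact Finset.sum_nonneg fun i _ => abs_nonneg _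

lemma coeff_sum_range_X_pow (m k : ℕ) :
    (∑ i ∈ Finset.range m, (X : ℝ[X]) ^ i).coeff k = if k < m then 1 else 0 := by
  simp [coeff_X_pow]

/-- A quotient of polynomials in `Pset` whose power series has nonnegative coefficients is
trivial as soon as the numerator has the smaller degree. -/
lemma exists_coeff_mul_inv_neg {p p' : ℝ[X]} (hp : p ∈ Pset) (hp' : p' ∈ Pset)
    (hdeg : p'.degree ≤ p.degree) (h0 : p.coeff 0 ≠ 0) (hne : p ≠ p') :
    ∃ n, PowerSeries.coeff n ((p : PowerSeries ℝ)⁻¹ * (p' : PowerSeries ℝ)) < 0 := by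
  by_contra! hf
  set f : PowerSeries ℝ := (p : PowerSeries ℝ)⁻¹ * (p' : PowerSeries ℝ) with hfdef
  have hc : PowerSeries.constantCoeff (p : PowerSeries ℝ) ≠ 0 := by simpa using h0
  have hfp : (p : PowerSeries ℝ) * f = p' := by
    rw [hfdef, ← mul_assoc, PowerSeries.mul_inv_cancel _ hc, one_mul]
  have hp0 : 0 < p.coeff 0 := lt_of_le_of_ne (hp.1 0) (Ne.symm h0)
  have hzero : ∀ k, p'.natDegree < k → PowerSeries.coeff k f = 0 := by
    intro k hk
    have h1 : PowerSeries.coeff k ((p : PowerSeries ℝ) * f) = 0 := by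
      rw [hfp, Polynomial.coeff_coe, coeff_eq_zero_of_natDegree_lt hk]
    rw [PowerSeries.coeff_mul] at h1
    have h2 := (Finset.sum_eq_zero_iff_of_nonneg (fun x _ => mul_nonneg
      (by rw [Polynomial.coeff_coe]; exact hp.1 x.1) (hf x.2))).mp h1 (0, k) (by simp)
    simpa [h0] using h2
  obtain ⟨g, hg⟩ : ∃ g : ℝ[X], (g : PowerSeries ℝ) = f := by
    refine ⟨PowerSeries.trunc (p'.natDegree + 1) f, ?_⟩
    ext k
    rw [Polynomial.coeff_coe, PowerSeries.coeff_trunc]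
    split_ifs with hk
    · rfl
    · exact (hzero k (by omega)).symm
  have hpg : p * g = p' := by
    apply Polynomial.coe_injective ℝ
    rw [Polynomial.coe_mul, hg, hfp]
  have hpne : p ≠ 0 := by rintro rfl; simp at h0
  have hgne : g ≠ 0 := by
    rintro rfl
    have := hp'.2
    rw [← hpg] at this
    simp at this
  have hgdeg : g.natDegree = 0 := by
    have h1 := natDegree_mul hpne hgne
    have h2 := natDegree_le_natDegree hdeg
    rw [hpg] at h1
    omega
  obtain ⟨c, rfl⟩ := natDegree_eq_zero.mp hgdeg
  have h1 := hp'.2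
  rw [← hpg, eval_mul, hp.2, eval_C, one_mul] at h1
  apply hne
  rw [← hpg, h1, C_1, mul_one]

lemma exists_multiplier {p p' : ℝ[X]} (hp : p ∈ Pset) (hp' : p' ∈ Pset)
    (hdeg : p'.degree ≤ p.degree) (h0 : p.coeff 0 ≠ 0) (hne : p ≠ p') :
    ∃ (q : ℝ[X]) (D n : ℕ), q.natDegree ≤ D ∧
      (∀ j ≤ D + p.natDegree, 0 < (q * p).coeff j) ∧ (q * p').coeff n < 0 := by
  obtain ⟨n, hn⟩ := exists_coeff_mul_inv_neg hp hp' hdeg h0 hne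
  have hc : PowerSeries.constantCoeff (p : PowerSeries ℝ) ≠ 0 := by simpa using h0
  have hp0 : 0 < p.coeff 0 := lt_of_le_of_ne (hp.1 0) (Ne.symm h0)
  set d := p.natDegree with hd
  have hpd : 0 < p.coeff d := by
    refine lt_of_le_of_ne (hp.1 d) (Ne.symm ?_)
    change p.leadingCoeff ≠ 0
    rw [leadingCoeff_ne_zero]
    rintro rfl
    simp at h0
  set a : PowerSeries ℝ := (p : PowerSeries ℝ)⁻¹ with ha
  set fn := PowerSeries.coeff n (a * (p' : PowerSeries ℝ)) with hfn
  set t : ℝ[X] := PowerSeries.trunc (n + 1) a with ht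
  have htr : ∀ (r : ℝ[X]) (j : ℕ), j ≤ n →
      (t * r).coeff j = PowerSeries.coeff j (a * (r : PowerSeries ℝ)) := by
    intro r j hj
    rw [coeff_mul, PowerSeries.coeff_mul]
    refine Finset.sum_congr rfl fun x hx => ?_
    have hx' := Finset.HasAntidiagonal.mem_antidiagonal.mp hx
    rw [ht, PowerSeries.coeff_trunc, if_pos (by omega), Polynomial.coeff_coe]
  let G : ℕ → ℝ[X] := fun m => ∑ i ∈ Finset.range m, X ^ i
  have hGc : ∀ m k, (G m).coeff k = if k < m then 1 else 0 := coeff_sum_range_X_pow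
  have hG0 : ∀ m k, 0 ≤ (G m).coeff k := fun m k => by rw [hGc]; split_ifs <;> norm_num
  have hG1 : ∀ m k, |(G m).coeff k| ≤ 1 := fun m k => by rw [hGc]; split_ifs <;> norm_num
  obtain ⟨B, hB0, hB⟩ := exists_abs_coeff_le (t * p)
  obtain ⟨M, hM0, hM1, hM2⟩ : ∃ M : ℝ, 0 ≤ M ∧ B < M * p.coeff 0 ∧ B < M * p.coeff d := by
    refine ⟨(B + 1) / p.coeff 0 + (B + 1) / p.coeff d, by positivity, ?_, ?_⟩
    · have : 0 ≤ (B + 1) / p.coeff d * p.coeff 0 := by positivity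
      rw [add_mul, div_mul_cancel₀ _ hp0.ne']
      linarith
    · have : 0 ≤ (B + 1) / p.coeff 0 * p.coeff d := by positivity
      rw [add_mul, div_mul_cancel₀ _ hpd.ne']
      linarith
  set δ : ℝ := -fn / 2 with hδ
  have hδ0 : 0 < δ := by linarith
  have hcoeff : ∀ (r : ℝ[X]) (j : ℕ),
      ((t + C M * (G (d + 1) * X ^ (n + 1)) + C δ * G (n + 1)) * r).coeff j =
      (t * r).coeff j + M * (if n + 1 ≤ j then (G (d + 1) * r).coeff (j - (n + 1)) else 0)
        + δ * (G (n + 1) * r).coeff j := by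
    intro r j
    have : (t + C M * (G (d + 1) * X ^ (n + 1)) + C δ * G (n + 1)) * r =
      t * r + C M * (G (d + 1) * r * X ^ (n + 1)) + C δ * (G (n + 1) * r) := by ring
    rw [this, coeff_add, coeff_add, coeff_C_mul, coeff_C_mul, coeff_mul_X_pow']
  refine ⟨t + C M * (G (d + 1) * X ^ (n + 1)) + C δ * G (n + 1), n + 1 + d, n, ?_, ?_, ?_⟩
  · rw [natDegree_le_iff_coeff_eq_zero]
    intro k hk
    rw [coeff_add, coeff_add, coeff_C_mul, coeff_C_mul, coeff_mul_X_pow', ht,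
      PowerSeries.coeff_trunc, hGc, hGc, if_neg (by omega), if_pos (by omega), if_neg (by omega),
      if_neg (by omega)]
    simp
  · intro j hj
    rw [hcoeff]
    have hG := coeff_mul_nonneg (hG0 (n + 1)) hp.1 j
    by_cases hjn : j ≤ n
    · rw [if_neg (by omega), htr p j hjn, ha, PowerSeries.inv_mul_cancel _ hc,
        PowerSeries.coeff_one]
      have h1 := coeff_mul_coeff_le_coeff_mul (hG0 (n + 1)) hp.1 j 0
      rw [hGc, if_pos (by omega), one_mul, add_zero] at h1
      have h2 : 0 < δ * (G (n + 1) * p).coeff j := mul_pos hδ0 (hp0.trans_le h1)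
      split_ifs <;> linarith
    · rw [if_pos (by omega)]
      have hBj := (abs_le.mp (hB j)).1
      have h2 : 0 ≤ δ * (G (n + 1) * p).coeff j := mul_nonneg hδ0.le hG
      by_cases hjd : j - (n + 1) ≤ d
      · have h1 := coeff_mul_coeff_le_coeff_mul (hG0 (d + 1)) hp.1 (j - (n + 1)) 0
        rw [hGc, if_pos (by omega), one_mul, add_zero] at h1
        have h3 := mul_le_mul_of_nonneg_left h1 hM0
        linarith
      · have h1 := coeff_mul_coeff_le_coeff_mul (hG0 (d + 1)) hp.1 (j - (n + 1) - d) d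
        rw [hGc, if_pos (by omega), one_mul, Nat.sub_add_cancel (by omega)] at h1
        have h3 := mul_le_mul_of_nonneg_left h1 hM0
        linarith
  · rw [hcoeff, if_neg (by omega), htr p' n le_rfl]
    have h1 := (abs_le.mp (abs_coeff_mul_le hp' (hG1 (n + 1)) n)).2
    have h2 := mul_le_mul_of_nonneg_left h1 hδ0.le
    linarith

theorem stmt_17 (p p' : Polynomial ℝ) (hp : p ∈ Pset) (hp' : p' ∈ Pset)
    (hdeg : p'.degree ≤ p.degree) (h0 : p.coeff 0 ≠ 0) (hne : p ≠ p') :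
    ∃ q ∈ Mset, ∃ ε : ℝ, 0 < ε ∧
      q * p ∈ Pset ∧
      q * p' ∉ Pset ∧
      ∀ q' ∈ Mset, q'.degree = q.degree →
        (∀ k : ℕ, |q'.coeff k - q.coeff k| < ε) → q' * p ∈ Pset := by
  obtain ⟨s, D, n, hsD, hspos, hsneg⟩ := exists_multiplier hp hp' hdeg h0 hne
  have hp0 : 0 < p.coeff 0 := lt_of_le_of_ne (hp.1 0) (Ne.symm h0)
  have hzero : ∀ r : ℝ[X], r.natDegree ≤ D → ∀ j, D + p.natDegree < j → (r * p).coeff j = 0 :=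
    fun r hr j hj => coeff_eq_zero_of_natDegree_lt
      ((natDegree_mul_le.trans (Nat.add_le_add_right hr _)).trans_lt hj)
  have hsp : ∀ j, 0 ≤ (s * p).coeff j := fun j => by
    rcases le_or_gt j (D + p.natDegree) with hj | hj
    · exact (hspos j hj).le
    · exact (hzero s hsD j hj).ge
  have hsx : ∀ x : ℝ, 0 < x → 0 < s.eval x := fun x hx => by
    have h := eval_pos_of_coeff_nonneg hsp (hspos 0 (Nat.zero_le _)) hx
    rw [eval_mul] at h
    exact pos_of_mul_pos_left h (eval_pos_of_coeff_nonneg hp.1 hp0 hx).le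
  have hs1 := hsx 1 one_pos
  set c : ℝ := (s.eval 1)⁻¹ with hc
  have hcpos : 0 < c := inv_pos.mpr hs1
  have hcoeff : ∀ (r : ℝ[X]) (j : ℕ), (C c * s * r).coeff j = c * (s * r).coeff j :=
    fun r j => by rw [mul_assoc, coeff_C_mul]
  have hq1 : (C c * s).eval 1 = 1 := by
    rw [eval_mul, eval_C, hc, inv_mul_cancel₀ hs1.ne']
  obtain ⟨j₀, hj₀, hmin⟩ := Finset.exists_min_image (Finset.range (D + p.natDegree + 1))
    (fun j => (C c * s * p).coeff j) ⟨0, by simp⟩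
  refine ⟨C c * s, ⟨hq1, fun x hx => ?_⟩, (C c * s * p).coeff j₀, ?_, ⟨fun j => ?_, ?_⟩, ?_, ?_⟩
  · rw [eval_mul, eval_C]
    exact mul_pos hcpos (hsx x hx)
  · rw [hcoeff]
    exact mul_pos hcpos (hspos j₀ (by simpa [Nat.lt_succ_iff] using hj₀))
  · rw [hcoeff]
    exact mul_nonneg hcpos.le (hsp j)
  · rw [eval_mul, hq1, hp.2, one_mul]
  · intro h
    have h1 := h.1 n
    rw [hcoeff] at h1
    exact absurd h1 (not_le.mpr (mul_neg_of_pos_of_neg hcpos hsneg))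
  · intro q' hq' hdeg' hclose
    refine ⟨fun j => ?_, by rw [eval_mul, hq'.1, hp.2, one_mul]⟩
    rcases le_or_gt j (D + p.natDegree) with hj | hj
    · have h1 := (abs_le.mp (abs_coeff_mul_le (g := q' - C c * s) hp
        (fun k => by rw [coeff_sub]; exact (hclose k).le) j)).1
      rw [sub_mul, coeff_sub] at h1
      have h2 := hmin j (by simpa [Nat.lt_succ_iff] using hj)
      linarith
    · refine (hzero q' ?_ j hj).ge
      rw [natDegree_eq_of_degree_eq hdeg']
      exact (natDegree_C_mul_le c s).trans hsD
end
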